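/- For fixed real utilities u and v with u < v, the function β ↦ exp(β·u)/(exp(β·u) + exp(β·v)) is strictly decreasing on [0, ∞); in particular it is injective, so the rationality parameter β is uniquely determined by the preference probability on a fixed pair of items with distinct utilities. -/

import Mathlib

/-- For u < v, β ↦ exp(β·u)/(exp(β·u) + exp(β·v)) is strictly
decreasing on [0, ∞), hence injective there. -/
theorem boltzmann_strictAnti_in_beta
    (u v : ℝ) (huv : u < v) :
    StrictAntiOn (fun β : ℝ =>
        Real.exp (β * u) / (Real.exp (β * u) + Real.exp (β * v)))
      (Set.Ici 0) ∧
    Set.InjOn (fun β : ℝ =>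
        Real.exp (β * u) / (Real.exp (β * u) + Real.exp (β * v)))
      (Set.Ici 0) := by
  have h : StrictAntiOn (fun β : ℝ =>
        Real.exp (β * u) / (Real.exp (β * u) + Real.exp (β * v)))
      (Set.Ici 0) := by
    intro a _ b _ hab
    show Real.exp (b * u) / (Real.exp (b * u) + Real.exp (b * v)) <
      Real.exp (a * u) / (Real.exp (a * u) + Real.exp (a * v))
    rw [div_lt_div_iff₀ (by positivity) (by positivity)]
    have key : Real.exp (b * u) * Real.exp (a * v) < Real.exp (a * u) * Real.exp (b * v) := by
      rw [← Real.exp_add, ← Real.exp_add, Real.exp_lt_exp]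
      nlinarith [mul_pos (sub_pos.2 hab) (sub_pos.2 huv)]
    linarith [mul_comm (Real.exp (b * u)) (Real.exp (a * u)),
      mul_add (Real.exp (b * u)) (Real.exp (a * u)) (Real.exp (a * v)),
      mul_add (Real.exp (a * u)) (Real.exp (b * u)) (Real.exp (b * v))]
  exact ⟨h, h.injOn⟩
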